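/- arXiv:2101.06947 — 3 statements merged into one kernel-verified Lean document; each statement's English description precedes it below -/
import Mathlib

section
/- Let m be a squarefree positive integer, let O_{−m} be the ring of integers of the imaginary quadratic number field ℚ(√−m), and let PSL₂(O_{−m}) denote the quotient of the special linear group SL₂(O_{−m}) by its center {±I}. If an element γ of PSL₂(O_{−m}) has finite order n, then n is one of 1, 2, 3, 4 or 6. -/
/-- For a squarefree positive integer `m`, a field `K` satisfying these hypotheses is (isomorphic
to) the imaginary quadratic number field `ℚ(√-m)`: it is a number field of degree 2 over `ℚ`
containing a square root of `-m`. -/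
def IsImaginaryQuadraticFieldOf (m : ℕ) (K : Type*) [Field K] [NumberField K] : Prop :=
  Module.finrank ℚ K = 2 ∧ ∃ x : K, x ^ 2 = -(m : K)

/-- A unipotent element of finite order, in the sense `(A - 1) ^ 2 = 0`, is trivial in
characteristic zero. -/
theorem Matrix.eq_one_of_sub_one_sq_eq_zero_of_pow_eq_one {ι R : Type*} [Fintype ι] [DecidableEq ι]
    [CommRing R] [IsDomain R] [CharZero R] {A : Matrix ι ι R} (hA : (A - 1) ^ 2 = 0)
    {n : ℕ} (hn : n ≠ 0) (hAn : A ^ n = 1) : A = 1 := by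
  have hpow (k : ℕ) : A ^ k = 1 + k • (A - 1) := by
    induction k with
    | zero => simp
    | succ k ih =>
      have hmul : (A - 1) * A = A - 1 := by
        rw [← sub_eq_zero, ← hA]
        noncomm_ring
      rw [pow_succ, ih, add_mul, smul_mul_assoc, hmul, succ_nsmul, one_mul]
      abel
  have h := hpow n
  rw [hAn, left_eq_add] at h
  ext i j
  have hij := congrFun (congrFun h i) j
  rw [Matrix.smul_apply, Matrix.zero_apply, smul_eq_zero_iff_right hn, Matrix.sub_apply,
    sub_eq_zero] at hij
  exact hij

/-- The Cayley–Hamilton theorem for a matrix of determinant one and size two. -/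
theorem Matrix.SpecialLinearGroup.coe_sq_eq_trace_smul_sub_one {R : Type*} [CommRing R]
    (A : Matrix.SpecialLinearGroup (Fin 2) R) :
    (A : Matrix (Fin 2) (Fin 2) R) ^ 2 =
      (A : Matrix (Fin 2) (Fin 2) R).trace • (A : Matrix (Fin 2) (Fin 2) R) - 1 := by
  have hdet := A.det_coe
  rw [Matrix.det_fin_two] at hdet
  ext i j
  fin_cases i <;> fin_cases j <;>
    simp [pow_two, Matrix.mul_apply, Fin.sum_univ_two, Matrix.trace_fin_two] <;>
    first | ring1 | linear_combination -hdet

/-- A complex matrix of finite order, determinant one and size two has real trace in `[-2, 2]`. -/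
theorem Matrix.trace_im_eq_zero_and_abs_re_le_two_of_pow_eq_one {B : Matrix (Fin 2) (Fin 2) ℂ}
    (hdet : B.det = 1) {n : ℕ} (hn : n ≠ 0) (hB : B ^ n = 1) :
    B.trace.im = 0 ∧ |B.trace.re| ≤ 2 := by
  obtain ⟨z, hz⟩ : ∃ z : ℂ, 1 * (z * z) + (-B.trace) * z + 1 = 0 :=
    exists_quadratic_eq_zero one_ne_zero (IsAlgClosed.exists_eq_mul_self _)
  have hsing : (B - z • (1 : Matrix (Fin 2) (Fin 2) ℂ)).det = 0 := by
    rw [Matrix.det_fin_two] at hdet ⊢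
    rw [Matrix.trace_fin_two] at hz
    simp
    linear_combination hz + hdet
  obtain ⟨v, hv0, hv⟩ := Matrix.exists_mulVec_eq_zero_iff.mpr hsing
  have hBv : B.mulVec v = z • v := by
    rwa [Matrix.sub_mulVec, Matrix.smul_mulVec, Matrix.one_mulVec, sub_eq_zero] at hv
  have hpow (k : ℕ) : (B ^ k).mulVec v = z ^ k • v := by
    induction k with
    | zero => simp
    | succ k ih =>
      rw [pow_succ, ← Matrix.mulVec_mulVec, hBv, Matrix.mulVec_smul, ih, smul_smul, pow_succ']
  have hzn : z ^ n = 1 := by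
    have h := hpow n
    rw [hB, Matrix.one_mulVec] at h
    exact smul_left_injective ℂ hv0 (by simpa using h.symm)
  have hnorm : ‖z‖ = 1 := Complex.norm_eq_one_of_pow_eq_one hzn hn
  have hconj : z * (starRingEnd ℂ) z = 1 := by
    rw [Complex.mul_conj', hnorm]; simp
  have htr : B.trace = z + (starRingEnd ℂ) z := by
    linear_combination (-(starRingEnd ℂ) z) * hz + (z - B.trace) * hconj
  have hre := Complex.abs_re_le_norm z
  rw [hnorm] at hre
  rw [htr]
  refine ⟨by simp, ?_⟩
  rw [Complex.add_re, Complex.conj_re, ← two_mul, abs_mul, abs_two]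
  linarith

/-- An element of an imaginary quadratic field with real image in `ℂ` is rational. -/
theorem IsImaginaryQuadraticFieldOf.exists_ratCast_eq_of_im_eq_zero {m : ℕ} (hm : 0 < m)
    {K : Type*} [Field K] [NumberField K] (hK : IsImaginaryQuadraticFieldOf m K) (φ : K →+* ℂ)
    {t : K} (ht : (φ t).im = 0) : ∃ q : ℚ, (q : K) = t := by
  obtain ⟨hrank, x, hx⟩ := hK
  have hφx : φ x ^ 2 = -(m : ℂ) := by rw [← map_pow, hx]; simp
  have hmpos : (0 : ℝ) < m := by exact_mod_cast hm
  have him : (φ x).im ≠ 0 := by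
    intro h
    have := congrArg Complex.re hφx
    simp [pow_two, h] at this
    nlinarith [mul_self_nonneg (φ x).re]
  have hre : (φ x).re = 0 := by
    have := congrArg Complex.im hφx
    simp [pow_two] at this
    have : (φ x).re * (φ x).im = 0 := by linarith
    exact (mul_eq_zero.mp this).resolve_right him
  have hli : LinearIndependent ℚ ![(1 : K), x] := by
    rw [LinearIndependent.pair_iff]
    intro a b hab
    have h := congrArg φ hab
    rw [Rat.smul_def, Rat.smul_def] at h
    simp only [mul_one, map_add, map_mul, map_ratCast, map_zero] at h
    have hi := congrArg Complex.im h
    have hr := congrArg Complex.re h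
    simp [hre, him] at hi hr
    exact ⟨hr, hi⟩
  have hspan := hli.span_eq_top_of_card_eq_finrank (by simp [hrank])
  have hmem : t ∈ Submodule.span ℚ (Set.range ![(1 : K), x]) := hspan ▸ Submodule.mem_top
  rw [Matrix.range_cons, Matrix.range_cons, Matrix.range_empty, Set.union_empty,
    Set.singleton_union, Submodule.mem_span_pair] at hmem
  obtain ⟨a, b, rfl⟩ := hmem
  refine ⟨a, ?_⟩
  rw [Rat.smul_def, Rat.smul_def] at ht ⊢
  simp [him] at ht
  simp [ht]

/-- The trace of an element of finite order of `SL₂` over the integers of an imaginary quadratic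
field is a rational integer in `[-2, 2]`. -/
theorem IsImaginaryQuadraticFieldOf.exists_int_trace_eq {m : ℕ} (hm : 0 < m)
    {K : Type*} [Field K] [NumberField K] (hK : IsImaginaryQuadraticFieldOf m K)
    {A : Matrix.SpecialLinearGroup (Fin 2) (NumberField.RingOfIntegers K)}
    {n : ℕ} (hn : n ≠ 0) (hA : A ^ n = 1) :
    ∃ k : ℤ, A.1.trace = k ∧ |k| ≤ 2 := by
  obtain ⟨φ⟩ : Nonempty (K →+* ℂ) := inferInstance
  set ψ : NumberField.RingOfIntegers K →+* ℂ := φ.comp (algebraMap _ K) with hψ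
  have htr : (ψ.mapMatrix A.1).trace = φ (A.1.trace : K) := by
    simp [Matrix.trace_fin_two, hψ]
  have hdet : (ψ.mapMatrix A.1).det = 1 := by
    rw [← RingHom.map_det, A.2, map_one]
  have hpow : ψ.mapMatrix A.1 ^ n = 1 := by
    rw [← map_pow, ← Matrix.SpecialLinearGroup.coe_pow, hA]
    exact map_one _
  obtain ⟨him, hre⟩ := Matrix.trace_im_eq_zero_and_abs_re_le_two_of_pow_eq_one hdet hn hpow
  rw [htr] at him hre
  obtain ⟨q, hq⟩ := hK.exists_ratCast_eq_of_im_eq_zero hm φ him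
  have hint : IsIntegral ℤ q := by
    have h : IsIntegral ℤ (algebraMap ℚ K q) := by
      rw [eq_ratCast, hq]
      exact NumberField.RingOfIntegers.isIntegral_coe _
    exact (isIntegral_algebraMap_iff (algebraMap ℚ K).injective).mp h
  obtain ⟨k, rfl⟩ := IsIntegrallyClosed.isIntegral_iff.mp hint
  have hk : (k : K) = (A.1.trace : K) := by simpa using hq
  refine ⟨k, ?_, ?_⟩
  · apply NumberField.RingOfIntegers.coe_injective
    simpa using hk.symm
  · rw [← hk, map_intCast, Complex.intCast_re] at hre
    exact_mod_cast hre

/-- An element of finite order of `SL₂` over the integers of an imaginary quadratic field has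
central square or central cube. -/
theorem IsImaginaryQuadraticFieldOf.sq_or_cube_mem_center {m : ℕ} (hm : 0 < m)
    {K : Type*} [Field K] [NumberField K] (hK : IsImaginaryQuadraticFieldOf m K)
    {A : Matrix.SpecialLinearGroup (Fin 2) (NumberField.RingOfIntegers K)}
    {n : ℕ} (hn : n ≠ 0) (hA : A ^ n = 1) :
    A ^ 2 ∈ Subgroup.center (Matrix.SpecialLinearGroup (Fin 2) (NumberField.RingOfIntegers K)) ∨
      A ^ 3 ∈ Subgroup.center
        (Matrix.SpecialLinearGroup (Fin 2) (NumberField.RingOfIntegers K)) := by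
  have hneg : (-1 : Matrix.SpecialLinearGroup (Fin 2) (NumberField.RingOfIntegers K)) ∈
      Subgroup.center _ := by
    rw [Subgroup.mem_center_iff]
    intro g
    simp
  have hAn : A.1 ^ n = 1 := by
    rw [← Matrix.SpecialLinearGroup.coe_pow, hA]
    rfl
  obtain ⟨k, hk, hk2⟩ := hK.exists_int_trace_eq hm hn hA
  have hsq := A.coe_sq_eq_trace_smul_sub_one
  rw [hk] at hsq
  obtain ⟨h₁, h₂⟩ := abs_le.mp hk2
  interval_cases k
  · have h : -A.1 = 1 := by
      refine Matrix.eq_one_of_sub_one_sq_eq_zero_of_pow_eq_one (n := 2 * n) ?_ (by positivity) ?_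
      · have : (-A.1 - 1) ^ 2 = A.1 ^ 2 + 2 • A.1 + 1 := by noncomm_ring
        rw [this, hsq, Int.cast_neg, Int.cast_ofNat, neg_smul, ofNat_smul_eq_nsmul]
        abel
      · rw [(even_two_mul n).neg_pow, mul_comm, pow_mul, hAn, one_pow]
    left
    have : A = -1 := Subtype.ext (by simpa using (neg_eq_iff_eq_neg.mp h))
    rw [this]
    exact pow_mem hneg 2
  · right
    have : A ^ 3 = 1 := Subtype.ext <| by
      rw [Matrix.SpecialLinearGroup.coe_pow, Matrix.SpecialLinearGroup.coe_one, pow_succ, hsq]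
      simp only [Int.cast_neg, Int.cast_one, neg_smul, one_smul] at hsq ⊢
      rw [sub_mul, neg_mul, ← pow_two, hsq]
      noncomm_ring
    rw [this]
    exact one_mem _
  · left
    have : A ^ 2 = -1 := Subtype.ext <| by
      rw [Matrix.SpecialLinearGroup.coe_pow, hsq]
      simp
    rwa [this]
  · right
    have : A ^ 3 = -1 := Subtype.ext <| by
      rw [Matrix.SpecialLinearGroup.coe_pow, Matrix.SpecialLinearGroup.coe_neg,
        Matrix.SpecialLinearGroup.coe_one, pow_succ, hsq]
      simp only [Int.cast_one, one_smul] at hsq ⊢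
      rw [sub_mul, ← pow_two, hsq]
      noncomm_ring
    rwa [this]
  · have h : A.1 = 1 := by
      refine Matrix.eq_one_of_sub_one_sq_eq_zero_of_pow_eq_one ?_ hn hAn
      have : (A.1 - 1) ^ 2 = A.1 ^ 2 - 2 • A.1 + 1 := by noncomm_ring
      rw [this, hsq, Int.cast_ofNat, ofNat_smul_eq_nsmul]
      abel
    left
    have : A = 1 := Subtype.ext h
    rw [this]
    exact pow_mem (one_mem _) 2


/-- Let `m` be a squarefree positive integer, `O₋ₘ` the ring of integers of
`ℚ(√-m)`, and `PSL₂(O₋ₘ)` the quotient of `SL₂(O₋ₘ)` by its center `{±I}`. If an element `γ` of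
`PSL₂(O₋ₘ)` has finite order `n`, then `n ∈ {1, 2, 3, 4, 6}`. -/
theorem orderOf_mem_of_bianchi_group
    (m : ℕ) (hm : Squarefree m) (hm0 : 0 < m)
    (K : Type*) [Field K] [NumberField K]
    (hK : IsImaginaryQuadraticFieldOf m K)
    (γ : Matrix.SpecialLinearGroup (Fin 2) (NumberField.RingOfIntegers K) ⧸
      Subgroup.center (Matrix.SpecialLinearGroup (Fin 2) (NumberField.RingOfIntegers K)))
    (hγ : IsOfFinOrder γ) :
    orderOf γ ∈ ({1, 2, 3, 4, 6} : Set ℕ) := by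
  obtain ⟨n, hn, hγn⟩ := isOfFinOrder_iff_pow_eq_one.mp hγ
  induction γ using QuotientGroup.induction_on with | H A => ?_
  rw [← QuotientGroup.mk_pow, QuotientGroup.eq_one_iff,
    Matrix.SpecialLinearGroup.mem_center_iff] at hγn
  obtain ⟨r, hr, hrA⟩ := hγn
  have hA : A ^ (n * 2) = 1 := Subtype.ext <| by
    rw [pow_mul, Matrix.SpecialLinearGroup.coe_pow, ← hrA, ← map_pow]
    rw [Fintype.card_fin] at hr
    rw [hr, map_one]
    rfl
  rcases hK.sq_or_cube_mem_center hm0 (by positivity) hA with h | h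
  all_goals
    rw [← QuotientGroup.eq_one_iff, QuotientGroup.mk_pow] at h
    rcases (Nat.dvd_prime (by norm_num)).mp (orderOf_dvd_of_pow_eq_one h) with h | h <;>
      simp [h]
end

section
/- Let K be a number field and ℓ an odd prime. Then the group SL₂(K) contains an element of order ℓ if and only if there exists a primitive ℓ-th root of unity ζ in an algebraic closure of K such that ζ + ζ^{−1} lies in the image of K in that algebraic closure. -/
section QuadraticRelation

variable {L R : Type*} [Field L] [Ring R] [Algebra L R]

theorem sub_algebraMap_mul_pow_of_mul_self_eq {ζ : L} {a : R} (hζ : ζ ≠ 0)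
    (ha : a * a = (ζ + ζ⁻¹) • a - 1) (n : ℕ) :
    (a - algebraMap L R ζ) * a ^ n = ζ⁻¹ ^ n • (a - algebraMap L R ζ) := by
  have hbase : (a - algebraMap L R ζ) * a = ζ⁻¹ • (a - algebraMap L R ζ) := by
    rw [sub_mul, ha, smul_sub, ← Algebra.smul_def, Algebra.algebraMap_eq_smul_one, smul_smul,
      inv_mul_cancel₀ hζ, one_smul, add_smul]
    abel
  induction n with
  | zero => simp
  | succ n ih => rw [pow_succ, ← mul_assoc, ih, smul_mul_assoc, hbase, smul_smul, pow_succ]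

theorem pow_eq_one_of_mul_self_eq {ζ : L} {a : R} {n : ℕ} (hζ : ζ ≠ ζ⁻¹) (hn : ζ ^ n = 1)
    (ha : a * a = (ζ + ζ⁻¹) • a - 1) : a ^ n = 1 := by
  have hζ0 : ζ ≠ 0 := by rintro rfl; simp at hζ
  have h₁ := sub_algebraMap_mul_pow_of_mul_self_eq hζ0 ha n
  have h₂ := sub_algebraMap_mul_pow_of_mul_self_eq (ζ := ζ⁻¹) (inv_ne_zero hζ0)
    (by rwa [inv_inv, add_comm]) n
  rw [inv_pow, hn, inv_one, one_smul, sub_mul, ← Algebra.smul_def] at h₁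
  rw [inv_inv, hn, one_smul, sub_mul, ← Algebra.smul_def] at h₂
  have h : (ζ - ζ⁻¹) • (a ^ n - 1) = 0 := by
    rw [smul_sub, sub_smul, ← Algebra.algebraMap_eq_smul_one, map_sub, sub_eq_zero]
    have h := congr_arg₂ (· - ·) h₂ h₁
    simpa only [sub_sub_sub_cancel_left] using h
  exact sub_eq_zero.mp ((smul_eq_zero_iff_right (sub_ne_zero.mpr hζ)).mp h)

theorem root_pow_eq_one_of_mul_self_eq [Nontrivial R] {ζ : L} {a : R} {n : ℕ} (hζ : ζ ≠ 0)
    (ha : a * a = (ζ + ζ⁻¹) • a - 1) (hn : a ^ n = 1) : ζ ^ n = 1 := by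
  have h := sub_algebraMap_mul_pow_of_mul_self_eq hζ ha n
  rw [hn, mul_one, eq_comm, ← sub_eq_zero] at h
  have h' : (ζ⁻¹ ^ n - 1) • (a - algebraMap L R ζ) = 0 := by rwa [sub_smul, one_smul]
  rcases smul_eq_zero.mp h' with h | h
  · simpa [sub_eq_zero] using h
  · rw [sub_eq_zero.mp h, ← map_pow] at hn
    exact (algebraMap L R).injective (hn.trans (map_one _).symm)

theorem eq_one_of_mul_self_eq_of_pow_eq_one [CharZero L] {a : R} {n : ℕ} (hn0 : n ≠ 0)
    (ha : a * a = (2 : L) • a - 1) (hn : a ^ n = 1) : a = 1 := by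
  have hmul : (a - 1) * a = a - 1 := by
    rw [sub_mul, ha, two_smul]
    noncomm_ring
  have hpow (k : ℕ) : a ^ k = 1 + (k : L) • (a - 1) := by
    induction k with
    | zero => simp
    | succ k ih =>
      rw [pow_succ, ih, add_mul, smul_mul_assoc, hmul, Nat.cast_succ, add_smul, one_smul]
      noncomm_ring
  have h := hpow n
  rw [hn, left_eq_add, smul_eq_zero] at h
  exact sub_eq_zero.mp (h.resolve_left (Nat.cast_ne_zero.mpr hn0))

end QuadraticRelation

theorem Matrix.mul_self_eq_trace_smul_sub_one {S : Type*} [CommRing S]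
    {M : Matrix (Fin 2) (Fin 2) S} (hM : M.det = 1) : M * M = M.trace • M - 1 := by
  rw [Matrix.det_fin_two] at hM
  ext i j
  fin_cases i <;> fin_cases j <;>
    simp [Matrix.mul_apply, Fin.sum_univ_two, Matrix.trace_fin_two] <;> grind

theorem IsAlgClosed.exists_ne_zero_add_inv_eq {L : Type*} [Field L] [IsAlgClosed L] (t : L) :
    ∃ ζ : L, ζ ≠ 0 ∧ ζ + ζ⁻¹ = t := by
  obtain ⟨ζ, hζ⟩ := IsAlgClosed.exists_root
    (Polynomial.C 1 * Polynomial.X ^ 2 + Polynomial.C (-t) * Polynomial.X + Polynomial.C 1)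
    (by rw [Polynomial.degree_quadratic one_ne_zero]; decide)
  simp only [Polynomial.IsRoot.def, Polynomial.eval_add, Polynomial.eval_mul, Polynomial.eval_C,
    Polynomial.eval_pow, Polynomial.eval_X] at hζ
  have hζ0 : ζ ≠ 0 := by rintro rfl; simp at hζ
  refine ⟨ζ, hζ0, ?_⟩
  field_simp
  linear_combination hζ

/-- Let `K` be a number field and `ℓ` an odd prime. Then `SL₂(K)` contains an
element of order `ℓ` if and only if there exists a primitive `ℓ`-th root of unity `ζ` in an
algebraic closure of `K` such that `ζ + ζ⁻¹` lies in the image of `K`. -/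
theorem sl2_exists_element_of_odd_prime_order_iff
    (K : Type*) [Field K] [NumberField K] (ℓ : ℕ) (hℓ : ℓ.Prime) (hodd : Odd ℓ) :
    (∃ A : Matrix.SpecialLinearGroup (Fin 2) K, orderOf A = ℓ) ↔
      (∃ ζ : AlgebraicClosure K, IsPrimitiveRoot ζ ℓ ∧
        ∃ x : K, algebraMap K (AlgebraicClosure K) x = ζ + ζ⁻¹) := by
  have : Fact ℓ.Prime := ⟨hℓ⟩
  let φ := algebraMap K (AlgebraicClosure K)
  let f := Matrix.SpecialLinearGroup.map (n := Fin 2) φ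
  have hf : Function.Injective f := fun A B h ↦ by
    ext i j
    exact φ.injective (congr_fun₂ (congr_arg Subtype.val h) i j)
  have hrel (A : Matrix.SpecialLinearGroup (Fin 2) K) :
      (f A).1 * (f A).1 = φ A.1.trace • (f A).1 - 1 := by
    have htrace : (f A).1.trace = φ A.1.trace := by
      simp [f, Matrix.trace_fin_two]
    rw [← htrace]
    exact Matrix.mul_self_eq_trace_smul_sub_one (f A).2
  constructor
  · rintro ⟨A, hA⟩
    obtain ⟨ζ, hζ0, hζ⟩ := IsAlgClosed.exists_ne_zero_add_inv_eq (φ A.1.trace)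
    have hfA := hrel A
    have hpow : (f A).1 ^ ℓ = 1 := by
      rw [← Matrix.SpecialLinearGroup.coe_pow, ← map_pow, ← hA, pow_orderOf_eq_one, map_one,
        Matrix.SpecialLinearGroup.coe_one]
    have hζ1 : ζ ≠ 1 := by
      rintro rfl
      rw [← hζ, inv_one, one_add_one_eq_two] at hfA
      have h := eq_one_of_mul_self_eq_of_pow_eq_one hℓ.ne_zero hfA hpow
      have hA1 : A = 1 := hf (Subtype.ext (by rw [h, map_one]; rfl))
      rw [hA1, orderOf_one] at hA
      exact hℓ.one_lt.ne hA
    rw [← hζ] at hfA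
    have hroot := root_pow_eq_one_of_mul_self_eq hζ0 hfA hpow
    exact ⟨ζ, IsPrimitiveRoot.iff_orderOf.mpr (orderOf_eq_prime hroot hζ1), A.1.trace, hζ.symm⟩
  · rintro ⟨ζ, hζ, x, hx⟩
    let A : Matrix.SpecialLinearGroup (Fin 2) K := ⟨!![0, -1; 1, x], by simp [Matrix.det_fin_two]⟩
    have hne : ζ ≠ ζ⁻¹ := fun h ↦ by
      have hsq : ζ ^ 2 = 1 := by
        rw [sq]
        nth_rw 2 [h]
        exact mul_inv_cancel₀ (hζ.ne_zero hℓ.ne_zero)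
      have hle := (Nat.prime_dvd_prime_iff_eq hℓ Nat.prime_two).mp (hζ.dvd_of_pow_eq_one 2 hsq)
      subst hle
      exact absurd hodd (by decide)
    have hfA := hrel A
    have htrace : A.1.trace = x := by simp [A, Matrix.trace_fin_two]
    rw [htrace, hx] at hfA
    have hpow := pow_eq_one_of_mul_self_eq hne hζ.pow_eq_one hfA
    refine ⟨A, orderOf_eq_prime (hf (Subtype.ext ?_)) fun h ↦ ?_⟩
    · rw [map_pow, Matrix.SpecialLinearGroup.coe_pow, hpow, map_one,
        Matrix.SpecialLinearGroup.coe_one]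
    · simpa [A] using congr_fun₂ (congr_arg Subtype.val h) 1 0
end

section
/- Let m be a squarefree positive integer with m ∉ {1,3}, and let Γ be a finite index subgroup of the Bianchi group PSL₂(O_{−m}). Then the number of conjugacy classes of elements of order 3 in Γ equals 2λ₆ − λ₆*, where λ₆ is the number of conjugacy classes of subgroups of Γ isomorphic to ℤ/3 and λ₆* is the number of conjugacy classes of subgroups of Γ isomorphic to ℤ/3 that are contained in some subgroup of Γ isomorphic to the symmetric group S₃ of order 6. -/
open Pointwise

/-- The number of conjugacy classes of subgroups of `Γ` isomorphic to `A`: the number of orbits,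
under the conjugation action of `Γ` on its subgroups, which consist of subgroups isomorphic
to `A`. -/
noncomputable def subgroupConjClassCount (Γ : Type) [Group Γ] (A : Type*) [Group A] : ℕ :=
  Nat.card {C : Quotient (MulAction.orbitRel (ConjAct Γ) (Subgroup Γ)) //
    ∃ H : Subgroup Γ, Nonempty (H ≃* A) ∧ Quotient.mk'' H = C}

/-- The number of conjugacy classes of subgroups of `Γ` isomorphic to `A` which are contained in
some subgroup of `Γ` isomorphic to `B`. -/
noncomputable def subgroupConjClassCountIn (Γ : Type) [Group Γ]
    (A : Type*) [Group A] (B : Type*) [Group B] : ℕ :=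
  Nat.card {C : Quotient (MulAction.orbitRel (ConjAct Γ) (Subgroup Γ)) //
    ∃ H : Subgroup Γ, Nonempty (H ≃* A) ∧ (∃ K : Subgroup Γ, H ≤ K ∧ Nonempty (K ≃* B)) ∧
      Quotient.mk'' H = C}

/-- The number of conjugacy classes of elements of order `n` in `Γ`. -/
noncomputable def elementOrderConjClassCount (Γ : Type) [Group Γ] (n : ℕ) : ℕ :=
  Nat.card {c : ConjClasses Γ // ∃ g : Γ, ConjClasses.mk g = c ∧ orderOf g = n}

/-- The Bianchi group `PSL₂(O)`: the quotient of `SL₂(O)` by its center `{±I}`. -/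
abbrev BianchiPSL₂ (K : Type) [Field K] [NumberField K] : Type :=
  Matrix.SpecialLinearGroup (Fin 2) (NumberField.RingOfIntegers K) ⧸
    Subgroup.center (Matrix.SpecialLinearGroup (Fin 2) (NumberField.RingOfIntegers K))

theorem card_add_card_fixedPoints_of_fibers {E L : Type*} [Finite E] (π : E → L)
    (hπ : Function.Surjective π) (ι : E → E) (hfib : ∀ a b, π a = π b ↔ a = b ∨ a = ι b)
    (P : L → Prop) (hP : ∀ a, P (π a) ↔ ι a = a) :
    Nat.card E + Nat.card {l // P l} = 2 * Nat.card L := by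
  classical
  have : Fintype E := Fintype.ofFinite E
  have : Finite L := Finite.of_surjective π hπ
  have : Fintype L := Fintype.ofFinite L
  have hsum : Fintype.card E = ∑ l : L, (Finset.univ.filter fun a => π a = l).card :=
    Finset.card_eq_sum_card_fiberwise fun _ _ => Finset.mem_coe.2 (Finset.mem_univ _)
  have hcard : Fintype.card {l // P l} = ∑ l : L, if P l then 1 else 0 := by
    rw [Fintype.card_subtype, Finset.card_filter]
  simp only [Nat.card_eq_fintype_card]
  rw [hsum, hcard, ← Finset.sum_add_distrib, Finset.sum_const_nat (m := 2), Finset.card_univ,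
    mul_comm]
  intro l _
  obtain ⟨b, rfl⟩ := hπ l
  have hset : (Finset.univ.filter fun a => π a = π b) = {b, ι b} := by
    ext a
    simp [hfib]
  rw [hset]
  by_cases hb : ι b = b
  · simp [hb, (hP b).2 hb]
  · rw [if_neg (mt (hP b).1 hb), Finset.card_pair (Ne.symm hb)]

theorem nonempty_dihedralGroup_three_mulEquiv_perm :
    Nonempty (DihedralGroup 3 ≃* Equiv.Perm (Fin 3)) := by
  let σ : ZMod 3 → Equiv.Perm (ZMod 3) := fun i => Equiv.addRight i
  let τ : ZMod 3 → Equiv.Perm (ZMod 3) := fun i => Equiv.subLeft (-i)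
  let f : DihedralGroup 3 →* Equiv.Perm (Fin 3) :=
    { toFun := fun a => match a with
        | .r i => σ i
        | .sr i => τ i
      map_one' := by decide
      map_mul' := by decide }
  exact ⟨MulEquiv.ofBijective f (by decide)⟩

theorem exists_subgroup_mulEquiv_perm_three {G : Type*} [Group G] {g x : G} (hg : orderOf g = 3)
    (hx : orderOf x = 2) (hgx : x * g * x⁻¹ = g⁻¹) :
    ∃ S : Subgroup G, g ∈ S ∧ Nonempty (S ≃* Equiv.Perm (Fin 3)) := by
  have hg3 : g ^ 3 = 1 := hg ▸ pow_orderOf_eq_one g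
  have hxx : x * x = 1 := by rw [← sq, ← hx, pow_orderOf_eq_one]
  let p : ZMod 3 → G := fun i => g ^ i.val
  have hadd (i j) : p (i + j) = p i * p j := by
    change g ^ _ = g ^ _ * g ^ _
    rw [ZMod.val_add, ← pow_add]
    exact (pow_eq_pow_mod _ hg3).symm
  have hconj (i) : p i * x = x * (p i)⁻¹ := by
    have h : SemiconjBy x g g⁻¹ := by rw [SemiconjBy, ← hgx]; group
    have h2 := (h.pow_right i.val).inv_right
    rw [inv_pow, inv_inv] at h2
    exact h2.eq.symm
  have hsub (i j) : p (j - i) = (p i)⁻¹ * p j := by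
    rw [eq_inv_mul_iff_mul_eq, ← hadd]
    congr 1
    ring
  let f : DihedralGroup 3 →* G :=
    { toFun := fun a => match a with
        | .r i => p i
        | .sr i => x * p i
      map_one' := pow_zero g
      map_mul' := by
        rintro (i | i) (j | j)
        · exact hadd i j
        · change x * p (j - i) = p i * (x * p j)
          rw [hsub, ← mul_assoc, ← mul_assoc, hconj]
        · change x * p (i + j) = x * p i * p j
          rw [hadd, mul_assoc]
        · change p (j - i) = x * p i * (x * p j)
          rw [mul_assoc, ← mul_assoc (p i), hconj, hsub, ← mul_assoc, ← mul_assoc, hxx, one_mul] }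
  have hf : Function.Injective f := by
    rw [injective_iff_map_eq_one]
    rintro (i | i) h
    · change g ^ i.val = 1 at h
      have h2 := orderOf_dvd_of_pow_eq_one h
      rw [hg] at h2
      have h3 := Nat.eq_zero_of_dvd_of_lt h2 (ZMod.val_lt i)
      rw [(ZMod.val_eq_zero i).1 h3, DihedralGroup.r_zero]
    · change x * g ^ i.val = 1 at h
      have h2 : x ^ 3 = 1 := by
        rw [eq_inv_of_mul_eq_one_left h, inv_pow, ← pow_mul, mul_comm, pow_mul, hg3,
          one_pow, inv_one]
      have h3 := orderOf_dvd_of_pow_eq_one h2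
      rw [hx] at h3
      omega
  obtain ⟨e⟩ := nonempty_dihedralGroup_three_mulEquiv_perm
  refine ⟨f.range, ⟨.r 1, ?_⟩, ⟨(MonoidHom.ofInjective hf).symm.trans e⟩⟩
  change g ^ (1 : ZMod 3).val = g
  rw [show (1 : ZMod 3).val = 1 from rfl, pow_one]

theorem isConj_inv_of_mulEquiv_perm_three {G : Type*} [Group G] {g : G} (hg : orderOf g = 3)
    {S : Subgroup G} (hgS : g ∈ S) (e : S ≃* Equiv.Perm (Fin 3)) : IsConj g g⁻¹ := by
  have key : ∀ σ : Equiv.Perm (Fin 3), σ ^ 3 = 1 → ∃ τ : Equiv.Perm (Fin 3), τ * σ * τ⁻¹ = σ⁻¹ := by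
    decide
  have h3 : (⟨g, hgS⟩ : S) ^ 3 = 1 := by
    ext
    simp [← hg, pow_orderOf_eq_one]
  obtain ⟨τ, hτ⟩ := key (e ⟨g, hgS⟩) (by rw [← map_pow, h3, map_one])
  rw [isConj_iff]
  refine ⟨(e.symm τ : S), ?_⟩
  have := congrArg (fun y => ((e.symm y : S) : G)) hτ
  simpa using this

theorem zpowers_inj_of_orderOf_eq_three {G : Type*} [Group G] {g h : G} (hg : orderOf g = 3) :
    Subgroup.zpowers h = Subgroup.zpowers g ↔ h = g ∨ h = g⁻¹ := by
  constructor
  · intro hgh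
    have ho : orderOf h = 3 := by rw [← Nat.card_zpowers, hgh, Nat.card_zpowers, hg]
    have hmem : h ∈ Subgroup.zpowers g := hgh ▸ Subgroup.mem_zpowers h
    have hfin : IsOfFinOrder g := orderOf_pos_iff.1 (by omega)
    obtain ⟨n, hn, rfl⟩ : ∃ n < 3, g ^ n = h := by
      classical
      simpa [hg] using hfin.mem_zpowers_iff_mem_range_orderOf.1 hmem
    have hg3 : g ^ 3 = 1 := hg ▸ pow_orderOf_eq_one g
    interval_cases n
    · simp at ho
    · simp
    · right
      exact eq_inv_of_mul_eq_one_left (by simpa [← pow_succ] using hg3)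
  · rintro (rfl | rfl)
    · rfl
    · exact Subgroup.zpowers_inv

theorem nonempty_mulEquiv_zmod_three_iff {G : Type*} [Group G] {H : Subgroup G} :
    Nonempty (H ≃* Multiplicative (ZMod 3)) ↔ ∃ g, orderOf g = 3 ∧ Subgroup.zpowers g = H := by
  constructor
  · rintro ⟨e⟩
    have hcyc : IsCyclic H := isCyclic_of_surjective e.symm e.symm.surjective
    obtain ⟨g, hg⟩ := Subgroup.isCyclic_iff_exists_zpowers_eq_top H |>.1 hcyc
    refine ⟨g, ?_, hg⟩
    rw [← Nat.card_zpowers, hg, Nat.card_congr e.toEquiv]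
    simp
  · rintro ⟨g, hg, rfl⟩
    have h : Nat.card (Subgroup.zpowers g) = 3 := by rw [Nat.card_zpowers, hg]
    exact ⟨(h ▸ zmodCyclicMulEquiv (inferInstance : IsCyclic (Subgroup.zpowers g))).symm⟩

theorem smul_zpowers {G : Type*} [Group G] (c : ConjAct G) (g : G) :
    c • Subgroup.zpowers g = Subgroup.zpowers (c • g) := by
  exact MonoidHom.map_zpowers (MulDistribMulAction.toMonoidEnd (ConjAct G) G c) g

theorem zpowers_mem_orbit_iff {G : Type*} [Group G] {g h : G} (hg : orderOf g = 3) :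
    Subgroup.zpowers h ∈ MulAction.orbit (ConjAct G) (Subgroup.zpowers g) ↔
      IsConj h g ∨ IsConj h g⁻¹ := by
  have hc (c : ConjAct G) : orderOf (c • g) = 3 := by
    rw [← hg]
    exact MulEquiv.orderOf_eq (MulDistribMulAction.toMulEquiv G c) g
  constructor
  · rintro ⟨c, hc'⟩
    simp only [smul_zpowers] at hc'
    rcases (zpowers_inj_of_orderOf_eq_three (hc c)).1 hc'.symm with rfl | rfl
    · exact Or.inl (isConj_iff.2 ⟨_, rfl⟩ : IsConj g _).symm
    · refine Or.inr (isConj_iff.2 ⟨ConjAct.ofConjAct c, ?_⟩ : IsConj g⁻¹ _).symm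
      rw [ConjAct.smul_def]
      group
  · rintro (h1 | h1)
    · obtain ⟨c, rfl⟩ := isConj_iff.1 h1.symm
      exact ⟨ConjAct.toConjAct c, smul_zpowers _ _⟩
    · obtain ⟨c, rfl⟩ := isConj_iff.1 h1.symm
      refine ⟨ConjAct.toConjAct c, ?_⟩
      simp only [← Subgroup.zpowers_inv (g := g)]
      exact smul_zpowers _ _

/-- In a group with finitely many conjugacy classes of elements of order `3`, all of which are
inverted only by involutions, the classes of elements of order `3` are counted by the classes of
subgroups of order `3`. -/
theorem elementOrderConjClassCount_three_add (G : Type) [Group G]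
    (hfin : Finite {c : ConjClasses G // ∃ g : G, ConjClasses.mk g = c ∧ orderOf g = 3})
    (hinv : ∀ g x : G, orderOf g = 3 → x * g * x⁻¹ = g⁻¹ → orderOf x = 2) :
    elementOrderConjClassCount G 3 +
        subgroupConjClassCountIn G (Multiplicative (ZMod 3)) (Equiv.Perm (Fin 3)) =
      2 * subgroupConjClassCount G (Multiplicative (ZMod 3)) := by
  let E := {c : ConjClasses G // ∃ g : G, ConjClasses.mk g = c ∧ orderOf g = 3}
  let Q := Quotient (MulAction.orbitRel (ConjAct G) (Subgroup G))
  let L := {C : Q // ∃ H : Subgroup G,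
    Nonempty (H ≃* Multiplicative (ZMod 3)) ∧ Quotient.mk'' H = C}
  let P : L → Prop := fun l => ∃ H : Subgroup G, Nonempty (H ≃* Multiplicative (ZMod 3)) ∧
    (∃ S : Subgroup G, H ≤ S ∧ Nonempty (S ≃* Equiv.Perm (Fin 3))) ∧ Quotient.mk'' H = l.1
  let π₀ : ConjClasses G → Q := Quotient.lift (fun g => Quotient.mk'' (Subgroup.zpowers g)) (by
    intro a b hab
    obtain ⟨c, rfl⟩ := isConj_iff.1 (show IsConj b a from IsConj.symm hab)
    exact Quotient.sound' ⟨ConjAct.toConjAct c, smul_zpowers _ _⟩)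
  let π : E → L := fun c => ⟨π₀ c.1, by
    obtain ⟨g, hg, ho⟩ := c.2
    exact ⟨Subgroup.zpowers g, nonempty_mulEquiv_zmod_three_iff.2 ⟨g, ho, rfl⟩, by rw [← hg]; rfl⟩⟩
  have hι (a b : G) (h : IsConj a b) : IsConj a⁻¹ b⁻¹ := by
    obtain ⟨c, rfl⟩ := isConj_iff.1 h
    exact isConj_iff.2 ⟨c, by group⟩
  let ι₀ : ConjClasses G → ConjClasses G := Quotient.map (fun g => g⁻¹) hι
  let ι : E → E := fun c => ⟨ι₀ c.1, by
    obtain ⟨g, hg, ho⟩ := c.2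
    exact ⟨g⁻¹, by rw [← hg]; rfl, by rw [orderOf_inv, ho]⟩⟩
  have hcount : subgroupConjClassCountIn G (Multiplicative (ZMod 3)) (Equiv.Perm (Fin 3)) =
      Nat.card {l // P l} :=
    Nat.card_congr
      { toFun := fun C => ⟨⟨C.1, let ⟨H, h1, _, h3⟩ := C.2; ⟨H, h1, h3⟩⟩, C.2⟩
        invFun := fun l => ⟨l.1.1, l.2⟩
        left_inv := fun _ => rfl
        right_inv := fun _ => rfl }
  rw [hcount]
  have hmk (g : G) (ho : orderOf g = 3) (H : Subgroup G) :
      (Quotient.mk'' H : Q) = π₀ (ConjClasses.mk g) ↔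
        H ∈ MulAction.orbit (ConjAct G) (Subgroup.zpowers g) := Quotient.eq''
  refine card_add_card_fixedPoints_of_fibers (E := E) (L := L) π ?_ ι ?_ P ?_
  · rintro ⟨_, H, hH, rfl⟩
    obtain ⟨g, ho, rfl⟩ := nonempty_mulEquiv_zmod_three_iff.1 hH
    exact ⟨⟨ConjClasses.mk g, g, rfl, ho⟩, rfl⟩
  · rintro ⟨_, a, rfl, ha⟩ ⟨_, b, rfl, hb⟩
    rw [Subtype.ext_iff, Subtype.ext_iff, Subtype.ext_iff]
    refine (hmk b hb _).trans <| (zpowers_mem_orbit_iff hb).trans ?_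
    rw [← ConjClasses.mk_eq_mk_iff_isConj, ← ConjClasses.mk_eq_mk_iff_isConj]
    rfl
  · rintro ⟨_, g, rfl, ho⟩
    have hfix : ι ⟨_, g, rfl, ho⟩ = ⟨_, g, rfl, ho⟩ ↔ IsConj g⁻¹ g := by
      rw [Subtype.ext_iff, ← ConjClasses.mk_eq_mk_iff_isConj]
      rfl
    rw [hfix]
    constructor
    · rintro ⟨H, hH, ⟨S, hHS, ⟨e⟩⟩, hHg⟩
      obtain ⟨h, hh, rfl⟩ := nonempty_mulEquiv_zmod_three_iff.1 hH
      have hh' := isConj_inv_of_mulEquiv_perm_three hh (hHS (Subgroup.mem_zpowers h)) e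
      rcases (zpowers_mem_orbit_iff ho).1 ((hmk g ho _).1 hHg) with h1 | h1
      · exact ((hι _ _ h1).symm.trans hh'.symm).trans h1
      · simpa using (h1.symm.trans hh').trans (hι _ _ h1)
    · intro hc
      obtain ⟨x, hx⟩ := isConj_iff.1 hc.symm
      obtain ⟨S, hgS, hS⟩ := exists_subgroup_mulEquiv_perm_three ho (hinv g x ho hx) hx
      exact ⟨Subgroup.zpowers g, nonempty_mulEquiv_zmod_three_iff.2 ⟨g, ho, rfl⟩,
        ⟨S, by simpa using hgS, hS⟩, rfl⟩

/-- A finite index subgroup inherits finiteness of conjugacy classes of elements of order `n`. -/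
theorem finite_conjClasses_of_finiteIndex {G : Type*} [Group G] (Γ : Subgroup G) [Γ.FiniteIndex]
    (n : ℕ) {F : Set G} (hF : F.Finite) (h : ∀ g : G, orderOf g = n → ∃ f ∈ F, IsConj f g) :
    Finite {c : ConjClasses Γ // ∃ g : Γ, ConjClasses.mk g = c ∧ orderOf g = n} := by
  have : Finite F := hF
  have key (c : {c : ConjClasses Γ // ∃ g : Γ, ConjClasses.mk g = c ∧ orderOf g = n}) :
      ∃ (f : F) (p : G) (g : Γ), ConjClasses.mk g = c.1 ∧ p * f * p⁻¹ = g := by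
    obtain ⟨c, g, hg, ho⟩ := c
    obtain ⟨f, hf, hfg⟩ := h g (by rw [Subgroup.orderOf_coe, ho])
    obtain ⟨p, hp⟩ := isConj_iff.1 hfg
    exact ⟨⟨f, hf⟩, p, g, hg, hp⟩
  choose f p g hg hp using key
  refine Finite.of_injective (fun c => (f c, (((p c)⁻¹ : G) : G ⧸ Γ))) ?_
  intro c d hcd
  rw [Prod.mk.injEq] at hcd
  obtain ⟨hf, hpq⟩ := hcd
  rw [QuotientGroup.eq, inv_inv] at hpq
  apply Subtype.ext
  rw [← hg c, ← hg d, ConjClasses.mk_eq_mk_iff_isConj]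
  refine IsConj.symm (isConj_iff.2 ⟨⟨_, hpq⟩, ?_⟩)
  ext
  simp only [Subgroup.coe_mul, Subgroup.coe_inv, ← hp, hf]
  group

open Matrix in
theorem Matrix.mul_self_fin_two {R : Type*} [CommRing R] (A : Matrix (Fin 2) (Fin 2) R) :
    A * A = A.trace • A - A.det • 1 := by
  ext i j
  fin_cases i <;> fin_cases j <;>
    simp [Matrix.mul_apply, Fin.sum_univ_two, Matrix.trace_fin_two, Matrix.det_fin_two] <;> ring

open Matrix Matrix.SpecialLinearGroup in
/-- An element of order `3` of `PSL₂` lifts to an element of `SL₂` of trace `-1`. -/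
theorem exists_trace_eq_neg_one_of_orderOf_eq_three {R : Type*} [CommRing R] [IsDomain R]
    {g : SpecialLinearGroup (Fin 2) R ⧸ Subgroup.center (SpecialLinearGroup (Fin 2) R)}
    (hg : orderOf g = 3) :
    ∃ A : SpecialLinearGroup (Fin 2) R, QuotientGroup.mk A = g ∧ A.1.trace = -1 := by
  obtain ⟨A, rfl⟩ := QuotientGroup.mk_surjective g
  have h3 : A ^ 3 ∈ Subgroup.center (SpecialLinearGroup (Fin 2) R) := by
    rw [← QuotientGroup.eq_one_iff, QuotientGroup.mk_pow, ← hg, pow_orderOf_eq_one]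
  have h1 : A ∉ Subgroup.center (SpecialLinearGroup (Fin 2) R) := by
    rw [← QuotientGroup.eq_one_iff]
    intro h
    simp [h] at hg
  have hdet := A.det_coe
  obtain ⟨r, -, hr⟩ := mem_center_iff.1 h3
  set t := (A : Matrix (Fin 2) (Fin 2) R).trace with ht
  have hcube : (A : Matrix (Fin 2) (Fin 2) R) ^ 3 = (t ^ 2 - 1) • A.1 - t • 1 := by
    rw [pow_succ, pow_two, mul_self_fin_two, hdet, ← ht, sub_mul, smul_mul_assoc,
      mul_self_fin_two, hdet, ← ht]
    simp only [one_mul, smul_sub, smul_smul, sub_smul, one_smul, sq]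
    abel
  rw [coe_pow, hcube] at hr
  have e01 := congrFun₂ hr 0 1
  have e10 := congrFun₂ hr 1 0
  have e00 := congrFun₂ hr 0 0
  have e11 := congrFun₂ hr 1 1
  simp at e01 e10 e00 e11
  have ht2 : t ^ 2 - 1 = 0 := by
    by_contra hne
    refine h1 (mem_center_iff.2 ⟨A 0 0, ?_, ?_⟩)
    · have h01 := e01.resolve_left hne
      have hd : (t ^ 2 - 1) * (A 0 0 - A 1 1) = 0 := by linear_combination e11 - e00
      have hd' := (mul_eq_zero.1 hd).resolve_left hne
      rw [det_fin_two] at hdet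
      rw [Fintype.card_fin]
      linear_combination hdet + A 0 0 * hd' + A 1 0 * h01
    · have h01 := e01.resolve_left hne
      have h10 := e10.resolve_left hne
      have hd : (t ^ 2 - 1) * (A 0 0 - A 1 1) = 0 := by linear_combination e11 - e00
      have hd' := sub_eq_zero.1 ((mul_eq_zero.1 hd).resolve_left hne)
      ext i j
      fin_cases i <;> fin_cases j <;> simp [h01, h10, hd']
  have ht' : t = 1 ∨ t = -1 := by
    rw [← sq_eq_sq_iff_eq_or_eq_neg]
    linear_combination ht2
  rcases ht' with h | h
  · refine ⟨-A, ?_, by rw [coe_neg, trace_neg, ← ht, h]⟩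
    rw [QuotientGroup.eq, mem_center_iff]
    refine ⟨-1, by simp, ?_⟩
    rw [← neg_one_mul A, _root_.mul_inv_rev]
    ext i j
    fin_cases i <;> fin_cases j <;> simp
  · exact ⟨A, rfl, h⟩

open Matrix Matrix.SpecialLinearGroup in
theorem orderOf_eq_two_of_conj_eq_inv {R : Type*} [CommRing R] [IsDomain R]
    {g x : SpecialLinearGroup (Fin 2) R ⧸ Subgroup.center (SpecialLinearGroup (Fin 2) R)}
    (hg : orderOf g = 3) (hgx : x * g * x⁻¹ = g⁻¹) : orderOf x = 2 := by
  have hsq : g ^ 2 ≠ 1 := fun h => by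
    have := orderOf_dvd_of_pow_eq_one h
    rw [hg] at this
    omega
  obtain ⟨A, hA, htr⟩ := exists_trace_eq_neg_one_of_orderOf_eq_three hg
  obtain ⟨X, rfl⟩ := QuotientGroup.mk_surjective x
  have hcen : X * A * X⁻¹ * A ∈ Subgroup.center (SpecialLinearGroup (Fin 2) R) := by
    rw [← QuotientGroup.eq_one_iff]
    simp [hA, hgx]
  obtain ⟨r, -, hr⟩ := mem_center_iff.1 hcen
  have hr1 : r = 1 := by
    have h1 : X * A * X⁻¹ = X * A * X⁻¹ * A * A⁻¹ := by group
    have h2 := congrArg (fun Y : SpecialLinearGroup (Fin 2) R => Y.1.trace) h1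
    simp only [coe_mul _ A⁻¹, ← hr] at h2
    have h3 : (X * A * X⁻¹).1.trace = -1 := by
      rw [coe_mul, trace_mul_comm, ← coe_mul, inv_mul_cancel_left, htr]
    have h4 : (A⁻¹).1.trace = -1 := by
      rw [← htr, coe_inv, adjugate_fin_two, trace_fin_two, trace_fin_two]
      simp [add_comm]
    have h5 : (scalar (Fin 2) r * (A⁻¹).1).trace = r * (A⁻¹).1.trace := by
      rw [scalar_apply, ← smul_eq_diagonal_mul, trace_smul, smul_eq_mul]
    rw [h3] at h2
    linear_combination h2 + h5 + r * h4
  have hXA : X * A * X⁻¹ * A = 1 := by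
    ext1
    rw [← hr, hr1, map_one, coe_one]
  have htau : X.1.trace = 0 := by
    by_contra hne
    have hX := mul_self_fin_two X.1
    rw [X.det_coe, one_smul] at hX
    have hXX : X * X * A = A * (X * X) := by
      have h1 : X * A = A⁻¹ * X := by
        rw [← mul_inv_eq_iff_eq_mul, ← mul_eq_one_iff_eq_inv, hXA]
      have h2 : X * A⁻¹ = A * X := by
        rw [mul_inv_eq_iff_eq_mul, mul_assoc, h1, mul_inv_cancel_left]
      rw [mul_assoc, h1, ← mul_assoc, h2, mul_assoc]
    have hXX' := congrArg Subtype.val hXX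
    simp only [coe_mul, hX, sub_mul, mul_sub, one_mul, mul_one, sub_left_inj, smul_mul_assoc,
      mul_smul_comm] at hXX'
    have hcomm : X * A = A * X := Subtype.ext (smul_right_injective _ hne hXX')
    apply hsq
    rw [hcomm, mul_inv_cancel_right] at hXA
    rw [sq, ← hA, ← QuotientGroup.mk_mul, hXA, QuotientGroup.mk_one]
  refine orderOf_eq_prime ?_ fun h => hsq ?_
  · rw [← QuotientGroup.mk_pow, QuotientGroup.eq_one_iff, mem_center_iff]
    refine ⟨-1, by simp, ?_⟩
    rw [sq, coe_mul, mul_self_fin_two, htau, X.det_coe, map_neg, map_one]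
    simp
  · rw [h] at hgx
    rw [sq]
    nth_rewrite 1 [show g = g⁻¹ by simpa using hgx]
    exact inv_mul_cancel g

/-- Simultaneous Dirichlet approximation. -/
theorem exists_forall_abs_mul_sub_lt {ι : Type*} [Fintype ι] {n : ℕ} (hn : 0 < n) (r : ι → ℝ) :
    ∃ t : ℕ, 0 < t ∧ t ≤ n ^ Fintype.card ι ∧ ∃ z : ι → ℤ, ∀ i, |t * r i - z i| < 1 / n := by
  classical
  let f : ℕ → ι → ℤ := fun t i => ⌊n * Int.fract (t * r i)⌋
  have hn' : (0 : ℝ) < n := by exact_mod_cast hn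
  have hmaps : ∀ t ∈ Finset.range (n ^ Fintype.card ι + 1),
      f t ∈ Fintype.piFinset fun _ : ι => Finset.Ico (0 : ℤ) n := by
    intro t _
    simp only [Fintype.mem_piFinset, Finset.mem_Ico, f]
    intro i
    refine ⟨Int.floor_nonneg.2 (mul_nonneg hn'.le (Int.fract_nonneg _)), Int.floor_lt.2 ?_⟩
    have := mul_lt_mul_of_pos_left (Int.fract_lt_one (t * r i)) hn'
    simpa using this
  obtain ⟨a, ha, b, hb, hab, hf⟩ :=
    Finset.exists_ne_map_eq_of_card_lt_of_maps_to (by simp) hmaps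
  wlog hlt : a < b generalizing a b
  · exact this b hb a ha hab.symm hf.symm (by omega)
  rw [Finset.mem_range] at hb
  refine ⟨b - a, by omega, by omega, fun i => ⌊b * r i⌋ - ⌊a * r i⌋, fun i => ?_⟩
  have h := Int.abs_sub_lt_one_of_floor_eq_floor (congrFun hf.symm i)
  rw [← mul_sub, abs_mul, abs_of_pos hn', ← lt_div_iff₀' hn'] at h
  rw [← Int.self_sub_floor, ← Int.self_sub_floor] at h
  have heq : ((b - a : ℕ) : ℝ) * r i - ((⌊b * r i⌋ - ⌊a * r i⌋ : ℤ) : ℝ) =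
      b * r i - ⌊b * r i⌋ - (a * r i - ⌊a * r i⌋) := by
    rw [Nat.cast_sub hlt.le]
    push_cast
    ring
  rw [heq]
  exact h

open NumberField Module in
theorem NumberField.exists_natCast_mul_sub_lt {K : Type*} [Field K] [NumberField K]
    (w : InfinitePlace K) {ε : ℝ} (hε : 0 < ε) :
    ∃ M : ℕ, ∀ x : Fin 2 → K, ∃ t : ℕ, 0 < t ∧ t ≤ M ∧
      ∃ z : Fin 2 → 𝓞 K, ∀ j, w (t * x j - z j) < ε := by
  classical
  set b := integralBasis K with hb
  set C : ℝ := ∑ i, w (b i) with hC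
  have hC0 : 0 ≤ C := Finset.sum_nonneg fun i _ => apply_nonneg _ _
  obtain ⟨n, hn⟩ := exists_nat_gt (C / ε)
  have hn' : (0 : ℝ) < n := (div_nonneg hC0 hε.le).trans_lt hn
  refine ⟨n ^ Fintype.card (Fin 2 × Free.ChooseBasisIndex ℤ (𝓞 K)), fun x => ?_⟩
  obtain ⟨t, ht0, htM, z, hz⟩ := exists_forall_abs_mul_sub_lt (Nat.cast_pos.1 hn')
    fun p : Fin 2 × Free.ChooseBasisIndex ℤ (𝓞 K) => ((b.repr (x p.1) p.2 : ℚ) : ℝ)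
  refine ⟨t, ht0, htM, fun j => ∑ i, z (j, i) • RingOfIntegers.basis K i, fun j => ?_⟩
  have hsum : t * x j - ((∑ i, z (j, i) • RingOfIntegers.basis K i : 𝓞 K) : K) =
      ∑ i, ((t * b.repr (x j) i - z (j, i) : ℚ) : K) * b i := by
    conv_lhs => rw [← b.sum_repr (x j)]
    rw [RingOfIntegers.coe_eq_algebraMap, Finset.mul_sum, map_sum, ← Finset.sum_sub_distrib]
    refine Finset.sum_congr rfl fun i _ => ?_
    rw [hb, integralBasis_apply, zsmul_eq_mul, map_mul, map_intCast, Algebra.smul_def]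
    push_cast
    simp
    ring
  rw [hsum]
  calc w (∑ i, ((t * b.repr (x j) i - z (j, i) : ℚ) : K) * b i)
      ≤ ∑ i, w (((t * b.repr (x j) i - z (j, i) : ℚ) : K) * b i) :=
        w.1.sum_le _ _
    _ ≤ ∑ i, (1 / n : ℝ) * w (b i) := by
        refine Finset.sum_le_sum fun i _ => ?_
        rw [map_mul]
        refine mul_le_mul_of_nonneg_right ?_ (apply_nonneg _ _)
        rw [← InfinitePlace.norm_embedding_eq, map_ratCast, Complex.norm_ratCast]
        exact_mod_cast (hz (j, i)).le
    _ = C / n := by rw [← Finset.mul_sum, ← hC]; ring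
    _ < ε := by
        rw [div_lt_iff₀ hε] at hn
        rw [div_lt_iff₀ hn']
        linarith

open NumberField in
theorem NumberField.finite_setOf_place_le {K : Type*} [Field K] [NumberField K]
    [Subsingleton (InfinitePlace K)] (w : InfinitePlace K) (B : ℝ) :
    {z : 𝓞 K | w z ≤ B}.Finite := by
  refine ((Embeddings.finite_of_norm_le K ℂ B).preimage
    (RingOfIntegers.coe_injective (K := K)).injOn).subset fun z hz => ?_
  refine ⟨z.isIntegral_coe, fun φ => ?_⟩
  rw [← InfinitePlace.apply, Subsingleton.elim (InfinitePlace.mk φ) w]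
  exact hz

open NumberField Module in
theorem NumberField.exists_eq_add_mul_of_finrank_eq_two {K : Type*} [Field K] [NumberField K]
    (hdeg : finrank ℚ K = 2) {m : ℕ} (hm : 0 < m) {x : K} (hx : x ^ 2 = -(m : K)) (y : K) :
    ∃ a b : ℚ, y = a + b * x := by
  have hm' : (0 : ℚ) < m := by exact_mod_cast hm
  have hli : LinearIndependent ℚ ![(1 : K), x] := by
    rw [LinearIndependent.pair_iff]
    intro s t h
    rw [Algebra.smul_def, Algebra.smul_def, mul_one, eq_ratCast, eq_ratCast] at h
    have h2 : ((s ^ 2 + m * t ^ 2 : ℚ) : K) = 0 := by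
      push_cast
      linear_combination (s - t * x) * h + (t : K) ^ 2 * hx
    rw [Rat.cast_eq_zero] at h2
    have ht : t ^ 2 = 0 := by nlinarith [sq_nonneg s, sq_nonneg t]
    have hs : s ^ 2 = 0 := by nlinarith [sq_nonneg s, sq_nonneg t]
    exact ⟨pow_eq_zero_iff two_ne_zero |>.1 hs, pow_eq_zero_iff two_ne_zero |>.1 ht⟩
  have hspan := hli.span_eq_top_of_card_eq_finrank (by simp [hdeg])
  have hy : y ∈ Submodule.span ℚ (Set.range ![(1 : K), x]) := hspan ▸ Submodule.mem_top
  rw [Matrix.range_cons, Matrix.range_cons, Matrix.range_empty, Set.union_empty,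
    Set.singleton_union, Submodule.mem_span_pair] at hy
  obtain ⟨a, b, rfl⟩ := hy
  exact ⟨a, b, by simp [Algebra.smul_def]⟩

open NumberField Module in
theorem NumberField.subsingleton_infinitePlace_of_sq_eq_neg {K : Type*} [Field K] [NumberField K]
    (hdeg : finrank ℚ K = 2) {m : ℕ} (hm : 0 < m) {x : K} (hx : x ^ 2 = -(m : K)) :
    Subsingleton (InfinitePlace K) := by
  have hcomplex : IsTotallyComplex K := by
    refine ⟨fun v => ?_⟩
    rw [← InfinitePlace.not_isReal_iff_isComplex]
    intro hv
    have h := congrArg (InfinitePlace.embedding_of_isReal hv) hx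
    rw [map_pow, map_neg, map_natCast] at h
    have : (0 : ℝ) < m := by exact_mod_cast hm
    nlinarith [sq_nonneg (InfinitePlace.embedding_of_isReal hv x)]
  have h1 := IsTotallyComplex.finrank (K := K)
  have h2 := nrRealPlaces_eq_zero_iff.2 hcomplex
  have h3 := InfinitePlace.card_eq_nrRealPlaces_add_nrComplexPlaces K
  rw [← Fintype.card_le_one_iff_subsingleton]
  omega

open Module in
theorem sq_add_self_add_one_ne_zero {K : Type*} [Field K] [NumberField K]
    (hdeg : finrank ℚ K = 2) {m : ℕ} (hm : Squarefree m) (hm0 : 0 < m) (hm3 : m ≠ 3) {x : K}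
    (hx : x ^ 2 = -(m : K)) (z : K) : z ^ 2 + z + 1 ≠ 0 := by
  intro hz
  obtain ⟨a, b, hab⟩ := NumberField.exists_eq_add_mul_of_finrank_eq_two hdeg hm0 hx (2 * z + 1)
  have hsq : ((a ^ 2 - m * b ^ 2 + 3 : ℚ) : K) + ((2 * a * b : ℚ) : K) * x = 0 := by
    push_cast
    linear_combination 4 * hz - (2 * z + 1 + a + b * x) * hab - (b : K) ^ 2 * hx
  have hm' : (0 : ℚ) < m := by exact_mod_cast hm0
  set p := a ^ 2 - m * b ^ 2 + 3
  set q := 2 * a * b with hq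
  have hpq : ((p ^ 2 + m * q ^ 2 : ℚ) : K) = 0 := by
    push_cast
    linear_combination (p - q * x) * hsq + (q : K) ^ 2 * hx
  rw [Rat.cast_eq_zero] at hpq
  have hq0 : q = 0 := by
    rw [← sq_eq_zero_iff]
    nlinarith [sq_nonneg p, sq_nonneg q]
  have hp0 : a ^ 2 - m * b ^ 2 + 3 = 0 := by
    rw [← sq_eq_zero_iff]
    change p ^ 2 = 0
    rw [hq0] at hpq
    linarith
  have ha : a = 0 := by
    rcases mul_eq_zero.1 (hq ▸ hq0) with h | h
    · simpa using h
    · rw [h] at hp0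
      nlinarith [sq_nonneg a]
  have hsq3 : IsSquare ((3 * m : ℕ) : ℚ) := ⟨m * b, by
    rw [ha] at hp0
    push_cast
    linear_combination (m : ℚ) * hp0⟩
  rw [Rat.isSquare_natCast_iff] at hsq3
  obtain ⟨k, hk⟩ := hsq3
  obtain ⟨l, rfl⟩ : 3 ∣ k := (Nat.prime_three.dvd_mul.1 (hk ▸ dvd_mul_right 3 m)).elim id id
  have hml : m = 3 * (l * l) := by linarith
  have hl : IsUnit l := hm l (hml ▸ dvd_mul_left _ _)
  rw [Nat.isUnit_iff] at hl
  exact hm3 (by rw [hml, hl])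

/-- The binary quadratic form `v ↦ det (v, A v)` attached to a `2 × 2` matrix `A`. -/
def Matrix.crossForm {R : Type*} [CommRing R] (A : Matrix (Fin 2) (Fin 2) R) (v : Fin 2 → R) : R :=
  v 0 * (A 1 0 * v 0 + A 1 1 * v 1) - v 1 * (A 0 0 * v 0 + A 0 1 * v 1)

theorem Matrix.crossForm_ne_zero {R K : Type*} [CommRing R] [Field K] [Algebra R K]
    [FaithfulSMul R K] (hK : ∀ z : K, z ^ 2 + z + 1 ≠ 0) {A : Matrix (Fin 2) (Fin 2) R}
    (hdet : A.det = 1) (htr : A.trace = -1) {v : Fin 2 → R} (hv : v ≠ 0) : A.crossForm v ≠ 0 := by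
  intro h
  rw [crossForm] at h
  rw [det_fin_two] at hdet
  rw [trace_fin_two] at htr
  have hinj := FaithfulSMul.algebraMap_injective R K
  have hR (z : R) : z ^ 2 + z + 1 ≠ 0 := fun hz => hK (algebraMap R K z) (by
    simpa using congrArg (algebraMap R K) hz)
  have : IsDomain R := hinj.isDomain
  by_cases hv1 : v 1 = 0
  · have hv0 : v 0 ≠ 0 := fun hv0 => hv (by ext i; fin_cases i <;> simp [hv0, hv1])
    have hc : A 1 0 = 0 := by simpa [hv1, hv0] using h
    apply hR (A 0 0)
    linear_combination A 0 0 * htr - hdet - A 0 1 * hc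
  · have hv1' : algebraMap R K (v 1) ≠ 0 := (map_ne_zero_iff _ hinj).2 hv1
    apply hK (algebraMap R K (A 1 0 * v 0 + A 1 1 * v 1) / algebraMap R K (v 1))
    have key : (A 1 0 * v 0 + A 1 1 * v 1) ^ 2 + (A 1 0 * v 0 + A 1 1 * v 1) * v 1 + v 1 ^ 2 = 0 := by
      linear_combination A 1 0 * h - v 1 ^ 2 * hdet + (A 1 0 * v 0 + A 1 1 * v 1) * v 1 * htr
    have key' := congrArg (algebraMap R K) key
    rw [map_add, map_add, map_pow, map_mul, map_pow, map_zero] at key'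
    simp only [map_add, map_mul] at key' ⊢
    field_simp
    linear_combination key'

theorem Matrix.mul_companion_eq {R : Type*} [CommRing R] {A : Matrix (Fin 2) (Fin 2) R}
    (hdet : A.det = 1) (htr : A.trace = -1) (v : Fin 2 → R) :
    A * !![v 0, A 0 0 * v 0 + A 0 1 * v 1; v 1, A 1 0 * v 0 + A 1 1 * v 1] =
      !![v 0, A 0 0 * v 0 + A 0 1 * v 1; v 1, A 1 0 * v 0 + A 1 1 * v 1] * !![0, -1; 1, -1] := by
  rw [det_fin_two] at hdet
  rw [trace_fin_two] at htr
  ext i j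
  fin_cases i <;> fin_cases j <;> simp [Matrix.mul_apply, Fin.sum_univ_two]
  · linear_combination (A 0 0 * v 0 + A 0 1 * v 1) * htr - v 0 * hdet
  · linear_combination (A 1 0 * v 0 + A 1 1 * v 1) * htr - v 1 * hdet

theorem Matrix.sq_mul_crossForm {R : Type*} [CommRing R] {A : Matrix (Fin 2) (Fin 2) R}
    (hdet : A.det = 1) (htr : A.trace = -1) (v u : Fin 2 → R) {c a b : R}
    (h0 : c * u 0 = a * v 0 + b * (A 0 0 * v 0 + A 0 1 * v 1))
    (h1 : c * u 1 = a * v 1 + b * (A 1 0 * v 0 + A 1 1 * v 1)) :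
    c ^ 2 * A.crossForm u = A.crossForm v * (a ^ 2 - a * b + b ^ 2) := by
  rw [det_fin_two] at hdet
  rw [trace_fin_two] at htr
  have hscale : c ^ 2 * A.crossForm u =
      (c * u 0) * (A 1 0 * (c * u 0) + A 1 1 * (c * u 1)) -
        (c * u 1) * (A 0 0 * (c * u 0) + A 0 1 * (c * u 1)) := by
    rw [crossForm]
    ring
  rw [hscale, h0, h1, crossForm]
  set g0 := A 0 0 * v 0 + A 0 1 * v 1 with hg0
  set g1 := A 1 0 * v 0 + A 1 1 * v 1 with hg1
  have hA0 : A 0 0 * g0 + A 0 1 * g1 = -g0 - v 0 := by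
    rw [hg0, hg1]
    linear_combination (A 0 0 * v 0 + A 0 1 * v 1) * htr - v 0 * hdet
  have hA1 : A 1 0 * g0 + A 1 1 * g1 = -g1 - v 1 := by
    rw [hg0, hg1]
    linear_combination (A 1 0 * v 0 + A 1 1 * v 1) * htr - v 1 * hdet
  linear_combination (a * v 0 + b * g0) * b * hA1 - (a * v 1 + b * g1) * b * hA0 +
    (a * v 1 + b * g1) * a * hg0 - (a * v 0 + b * g0) * a * hg1

open NumberField in
/-- A matrix of determinant `1` and trace `-1` is conjugate to the companion matrix of
`X ^ 2 + X + 1` by an integral matrix dividing a fixed integer. -/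
theorem exists_mul_companion_eq {K : Type*} [Field K] [NumberField K]
    [Subsingleton (InfinitePlace K)] (hK : ∀ z : K, z ^ 2 + z + 1 ≠ 0) :
    ∃ D : ℕ, D ≠ 0 ∧ ∀ G : Matrix (Fin 2) (Fin 2) (𝓞 K), G.det = 1 → G.trace = -1 →
      ∃ A B : Matrix (Fin 2) (Fin 2) (𝓞 K),
        A * B = (D : 𝓞 K) • 1 ∧ G * A = A * !![0, -1; 1, -1] := by
  obtain ⟨w⟩ : Nonempty (InfinitePlace K) := inferInstance
  obtain ⟨M, hM⟩ := exists_natCast_mul_sub_lt w (show (0 : ℝ) < 1 / 2 by norm_num)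
  refine ⟨M.factorial, M.factorial_ne_zero, fun G hdet htr => ?_⟩
  have hne {v : Fin 2 → 𝓞 K} (hv : v ≠ 0) : G.crossForm v ≠ 0 :=
    Matrix.crossForm_ne_zero hK hdet htr hv
  obtain ⟨v, hv, hmin⟩ : ∃ v : Fin 2 → 𝓞 K, v ≠ 0 ∧
      ∀ u : Fin 2 → 𝓞 K, u ≠ 0 → w (G.crossForm v) ≤ w (G.crossForm u) := by
    let e : Fin 2 → 𝓞 K := fun _ => 1
    have he : e ≠ 0 := fun h => one_ne_zero (congrFun h 0)
    let T : Set (𝓞 K) := {z | (∃ u, u ≠ 0 ∧ G.crossForm u = z) ∧ w z ≤ w (G.crossForm e)}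
    have hT : T.Finite := (finite_setOf_place_le w _).subset fun z hz => hz.2
    obtain ⟨_, ⟨⟨v, hv, rfl⟩, hve⟩, hmin⟩ :=
      T.exists_min_image (fun z => w z) hT ⟨_, ⟨e, he, rfl⟩, le_rfl⟩
    refine ⟨v, hv, fun u hu => ?_⟩
    by_cases hue : w (G.crossForm u) ≤ w (G.crossForm e)
    · exact hmin _ ⟨⟨u, hu, rfl⟩, hue⟩
    · exact hve.trans (le_of_not_ge hue)
  set q := G.crossForm v with hq
  have hq0 : (q : K) ≠ 0 := RingOfIntegers.coe_ne_zero_iff.2 (hne hv)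
  set g0 := G 0 0 * v 0 + G 0 1 * v 1 with hg0
  set g1 := G 1 0 * v 0 + G 1 1 * v 1 with hg1
  have hqg : q = v 0 * g1 - v 1 * g0 := rfl
  have hcol (e : Fin 2 → 𝓞 K) : ∃ y z : 𝓞 K,
      v 0 * y + g0 * z = M.factorial * e 0 ∧ v 1 * y + g1 * z = M.factorial * e 1 := by
    obtain ⟨t, ht0, htM, z, hz⟩ := hM
      ![(e 0 * g1 - e 1 * g0 : 𝓞 K) / (q : K), (v 0 * e 1 - v 1 * e 0 : 𝓞 K) / (q : K)]
    set u : Fin 2 → 𝓞 K :=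
      ![t * e 0 - z 0 * v 0 - z 1 * g0, t * e 1 - z 0 * v 1 - z 1 * g1] with hu
    have hu0 : u = 0 := by
      by_contra hu'
      refine (hmin u hu').not_gt ?_
      have h0 := hz 0
      have h1 := hz 1
      set α := (t : K) * ((e 0 * g1 - e 1 * g0 : 𝓞 K) / (q : K)) - z 0 with hα
      set β := (t : K) * ((v 0 * e 1 - v 1 * e 0 : 𝓞 K) / (q : K)) - z 1 with hβ
      change w α < 1 / 2 at h0
      change w β < 1 / 2 at h1
      have hqα : (q : K) * α = (t * (e 0 * g1 - e 1 * g0) - q * z 0 : 𝓞 K) := by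
        rw [hα]
        push_cast
        field_simp
      have hqβ : (q : K) * β = (t * (v 0 * e 1 - v 1 * e 0) - q * z 1 : 𝓞 K) := by
        rw [hβ]
        push_cast
        field_simp
      have hform : q * G.crossForm u =
          (t * (e 0 * g1 - e 1 * g0) - q * z 0) ^ 2 -
          (t * (e 0 * g1 - e 1 * g0) - q * z 0) * (t * (v 0 * e 1 - v 1 * e 0) - q * z 1) +
          (t * (v 0 * e 1 - v 1 * e 0) - q * z 1) ^ 2 := by
        refine mul_left_cancel₀ (hne hv) ?_
        rw [← mul_assoc, ← hq, ← sq]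
        refine Matrix.sq_mul_crossForm hdet htr v u ?_ ?_
        · simp only [hu, Matrix.cons_val_zero, ← hg0]
          rw [hqg]
          ring
        · simp only [hu, Matrix.cons_val_one, ← hg1]
          rw [hqg]
          simp
          ring
      have hform' : (G.crossForm u : K) = q * (α ^ 2 - α * β + β ^ 2) := by
        have := congrArg (fun z : 𝓞 K => (z : K)) hform
        simp only [map_mul, map_add, map_pow, map_sub] at this hqα hqβ
        apply mul_left_cancel₀ hq0
        rw [this, ← hqα, ← hqβ]
        ring
      rw [hform', map_mul]
      refine mul_lt_of_lt_one_right (InfinitePlace.pos_iff.2 hq0) ?_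
      have h2 : w (α ^ 2 - α * β + β ^ 2) ≤ w α ^ 2 + w α * w β + w β ^ 2 := by
        refine (w.1.add_le _ _).trans (add_le_add ((w.1.sub_le_add _ _).trans ?_) ?_)
        · exact (by rw [← map_pow, ← map_mul]; rfl)
        · exact (by rw [← map_pow]; rfl)
      have ha := apply_nonneg w α
      have hb := apply_nonneg w β
      nlinarith
    obtain ⟨k, hk⟩ := Nat.dvd_factorial ht0 htM
    have e0 : t * e 0 - z 0 * v 0 - z 1 * g0 = 0 := congrFun hu0 0
    have e1 : t * e 1 - z 0 * v 1 - z 1 * g1 = 0 := congrFun hu0 1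
    refine ⟨k * z 0, k * z 1, ?_, ?_⟩
    · rw [hk]
      push_cast
      linear_combination -(k : 𝓞 K) * e0
    · rw [hk]
      push_cast
      linear_combination -(k : 𝓞 K) * e1
  obtain ⟨y, z, hy0, hy1⟩ := hcol ![1, 0]
  obtain ⟨y', z', hz0, hz1⟩ := hcol ![0, 1]
  refine ⟨!![v 0, g0; v 1, g1], !![y, y'; z, z'], ?_, Matrix.mul_companion_eq hdet htr v⟩
  ext i j
  fin_cases i <;> fin_cases j <;> simp_all

open Matrix in
theorem isConj_of_mul_eq_of_det_eq_of_sub_eq_smul {R : Type*} [CommRing R] [IsDomain R]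
    {G G' : SpecialLinearGroup (Fin 2) R} {A B A' E J : Matrix (Fin 2) (Fin 2) R} {D : R}
    (hD : D ≠ 0) (hAB : A * B = D • 1) (hG : G.1 * A = A * J)
    (hG' : G'.1 * A' = A' * J) (hdet : A'.det = A.det) (hE : A' - A = D ^ 2 • E) :
    IsConj G G' := by
  have hdetAB : A.det * B.det = D ^ 2 := by
    rw [← det_mul, hAB, det_smul, det_one, Fintype.card_fin, mul_one]
  have hdetA : A.det ≠ 0 := fun h => pow_ne_zero 2 hD (by rw [← hdetAB, h, zero_mul])
  set g : Matrix (Fin 2) (Fin 2) R := 1 + B.det • (E * A.adjugate) with hg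
  have hgA : g * A = A' := by
    rw [hg, add_mul, one_mul, smul_mul_assoc, mul_assoc, adjugate_mul, mul_smul_comm, mul_one,
      smul_smul, mul_comm B.det, hdetAB, ← hE, add_sub_cancel]
  have hgdet : g.det = 1 := by
    refine mul_right_cancel₀ hdetA ?_
    rw [← det_mul, hgA, hdet, one_mul]
  let g' : SpecialLinearGroup (Fin 2) R := ⟨g, hgdet⟩
  refine isConj_iff.2 ⟨g', ?_⟩
  rw [mul_inv_eq_iff_eq_mul]
  refine Subtype.ext (smul_right_injective _ hD ?_)
  change D • (g * G.1) = D • (G'.1 * g)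
  rw [← mul_one (g * G.1), ← mul_one (G'.1 * g), ← mul_smul_comm, ← mul_smul_comm, ← hAB,
    ← mul_assoc, ← mul_assoc, mul_assoc g, hG, ← mul_assoc, hgA, mul_assoc G'.1, hgA, hG']

open NumberField Matrix in
/-- Matrices of determinant `1` and trace `-1` fall into finitely many conjugacy classes. -/
theorem exists_finite_isConj_of_trace_eq_neg_one {K : Type*} [Field K] [NumberField K]
    [Subsingleton (InfinitePlace K)] (hK : ∀ z : K, z ^ 2 + z + 1 ≠ 0) :
    ∃ F : Set (SpecialLinearGroup (Fin 2) (𝓞 K)), F.Finite ∧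
      ∀ G : SpecialLinearGroup (Fin 2) (𝓞 K), G.1.trace = -1 → ∃ f ∈ F, IsConj f G := by
  obtain ⟨w⟩ : Nonempty (InfinitePlace K) := inferInstance
  obtain ⟨D, hD, hAB⟩ := exists_mul_companion_eq hK
  have hD' : (D : 𝓞 K) ≠ 0 := Nat.cast_ne_zero.2 hD
  choose A B hmul hconj using fun G : {G : SpecialLinearGroup (Fin 2) (𝓞 K) // G.1.trace = -1} =>
    hAB G.1.1 G.1.2 G.2
  have hdet (G) : (A G).det * (B G).det = (D : 𝓞 K) ^ 2 := by
    rw [← det_mul, hmul, det_smul, det_one, Fintype.card_fin, mul_one]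
  have hbound (G) : w ((A G).det : K) ≤ w (D : K) ^ 2 := by
    have hB0 : (B G).det ≠ 0 := fun h => by
      have := hdet G
      rw [h, mul_zero] at this
      exact pow_ne_zero 2 hD' this.symm
    have h1 : 1 ≤ w ((B G).det : K) := InfinitePlace.one_le_of_lt_one hB0 fun z hz =>
      (hz (Subsingleton.elim _ _)).elim
    have h2 := congrArg (fun z : 𝓞 K => w (z : K)) (hdet G)
    simp only [map_mul, map_pow, map_natCast] at h2
    rw [← h2]
    exact le_mul_of_one_le_right (apply_nonneg _ _) h1
  let I : Ideal (𝓞 K) := Ideal.span {(D : 𝓞 K) ^ 2}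
  have hI : I ≠ ⊥ := by
    rw [Ne, Ideal.span_singleton_eq_bot]
    exact pow_ne_zero 2 hD'
  have : Finite (𝓞 K ⧸ I) := Ring.HasFiniteQuotients.finiteQuotient hI
  have : Finite {z : 𝓞 K | w z ≤ w (D : K) ^ 2} := finite_setOf_place_le w _
  let inv : {G : SpecialLinearGroup (Fin 2) (𝓞 K) // G.1.trace = -1} →
      {z : 𝓞 K | w z ≤ w (D : K) ^ 2} × (Fin 2 → Fin 2 → 𝓞 K ⧸ I) :=
    fun G => (⟨(A G).det, hbound G⟩, fun i j => Ideal.Quotient.mk I (A G i j))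
  refine ⟨Set.range (Subtype.val ∘ Set.rangeSplitting inv), Set.finite_range _, fun G hG => ?_⟩
  refine ⟨_, Set.mem_range_self ⟨inv ⟨G, hG⟩, Set.mem_range_self _⟩, ?_⟩
  have hinv := Set.apply_rangeSplitting inv ⟨inv ⟨G, hG⟩, Set.mem_range_self _⟩
  rw [Function.comp_apply]
  generalize Set.rangeSplitting inv _ = H at hinv ⊢
  rw [Prod.mk.injEq, Subtype.mk.injEq] at hinv
  obtain ⟨hinv_det, hinv_mod⟩ := hinv
  have hE (i j : Fin 2) : ∃ e, A ⟨G, hG⟩ i j - A H i j = D ^ 2 * e := by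
    rw [← dvd_def, ← Ideal.mem_span_singleton, ← Ideal.Quotient.eq]
    exact (congrFun₂ hinv_mod i j).symm
  choose E hE using hE
  exact isConj_of_mul_eq_of_det_eq_of_sub_eq_smul hD' (hmul H) (hconj H)
    (hconj ⟨G, hG⟩) hinv_det.symm (E := E) (Matrix.ext hE)

/-- Let `m ∉ {1,3}` be a squarefree positive integer and `Γ` a finite index
subgroup of the Bianchi group `PSL₂(O₋ₘ)` (where `K = ℚ(√-m)` is the imaginary quadratic field
of degree 2 over `ℚ` containing a square root of `-m`). Then the number of conjugacy classes of
elements of order `3` in `Γ` equals `2λ₆ - λ₆*`, where `λ₆` is the number of conjugacy classes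
of subgroups of `Γ` isomorphic to `ℤ/3` and `λ₆*` is the number of conjugacy classes of
subgroups isomorphic to `ℤ/3` contained in some subgroup isomorphic to `S₃`. -/
theorem conjClasses_order_three_of_bianchi_subgroup
    (m : ℕ) (hm : Squarefree m) (hm0 : 0 < m) (hm1 : m ≠ 1) (hm3 : m ≠ 3)
    (K : Type) [Field K] [NumberField K]
    (hdeg : Module.finrank ℚ K = 2) (hsqrt : ∃ x : K, x ^ 2 = -(m : K))
    (Γ : Subgroup (BianchiPSL₂ K)) (hΓ : Γ.FiniteIndex) :
    (elementOrderConjClassCount Γ 3 : ℤ) =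
      2 * (subgroupConjClassCount Γ (Multiplicative (ZMod 3)) : ℤ)
        - (subgroupConjClassCountIn Γ (Multiplicative (ZMod 3)) (Equiv.Perm (Fin 3)) : ℤ) := by
  obtain ⟨x, hx⟩ := hsqrt
  have := NumberField.subsingleton_infinitePlace_of_sq_eq_neg hdeg hm0 hx
  obtain ⟨F, hF, hconj⟩ := exists_finite_isConj_of_trace_eq_neg_one
    (sq_add_self_add_one_ne_zero hdeg hm hm0 hm3 hx)
  have hfin := finite_conjClasses_of_finiteIndex Γ 3 (hF.image QuotientGroup.mk) fun g hg => by
    obtain ⟨A, rfl, hA⟩ := exists_trace_eq_neg_one_of_orderOf_eq_three hg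
    obtain ⟨f, hf, hfA⟩ := hconj A hA
    exact ⟨_, ⟨f, hf, rfl⟩, (QuotientGroup.mk' _).map_isConj hfA⟩
  have hcount := elementOrderConjClassCount_three_add Γ hfin fun g x hg hgx => by
    rw [← Subgroup.orderOf_coe] at hg ⊢
    exact orderOf_eq_two_of_conj_eq_inv hg (by simpa using congrArg Subtype.val hgx)
  omega
end
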